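/- arXiv:2511.03362 — 2 statements merged into one kernel-verified Lean document; each statement's English description precedes it below -/
import Mathlib

section
/- Let x, y, z be real numbers with 0 < x < π, 0 < y < π, 0 < z < π and x + y + z = 2π. Then the partial sums ∑_{l=1}^{M} ((2 + (−1)^l)/l)(sin(lx) + sin(ly) + sin(lz)) tend to 0 as M → ∞. -/
open Real Filter

lemma aux_log (w : ℂ) (hw : ‖w‖ = 1) (h1 : w ≠ 1) :
    Tendsto (fun n : ℕ => ∑ i ∈ Finset.range n, w ^ i / (i : ℂ)) atTop
      (nhds (-Complex.log (1 - w))) := by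
  have hc : CauchySeq fun n : ℕ => ∑ i ∈ Finset.range n, (1 / ((i : ℝ) + 1)) • w ^ (i + 1) := by
    refine Antitone.cauchySeq_series_mul_of_tendsto_zero_of_bounded (b := 2 / ‖w - 1‖) ?_ ?_ ?_
    · intro a b hab
      have : (a : ℝ) ≤ b := by exact_mod_cast hab
      exact one_div_le_one_div_of_le (by positivity) (by linarith)
    · exact tendsto_one_div_add_atTop_nhds_zero_nat
    · intro n
      simp_rw [pow_succ]
      rw [← Finset.sum_mul, geom_sum_eq h1, norm_mul, norm_div, hw, mul_one]
      gcongr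
      calc ‖w ^ n - 1‖ ≤ ‖w ^ n‖ + ‖(1 : ℂ)‖ := norm_sub_le _ _
        _ = 2 := by rw [norm_pow, hw]; norm_num
  obtain ⟨l, hl⟩ := cauchySeq_tendsto_of_complete hc
  have hl' : Tendsto (fun n : ℕ => ∑ i ∈ Finset.range n, w ^ i / (i : ℂ)) atTop (nhds l) := by
    rw [← tendsto_add_atTop_iff_nat 1]
    convert hl using 2 with n
    rw [Finset.sum_range_succ']
    simp only [Nat.cast_zero, div_zero, add_zero]
    refine Finset.sum_congr rfl fun i _ => ?_
    rw [Complex.real_smul]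
    push_cast
    ring
  have hA := Complex.tendsto_tsum_powerSeries_nhdsWithin_lt hl'
  have hslit : 1 - w ∈ Complex.slitPlane := by
    left
    have h2 : w.re ≤ 1 := hw ▸ Complex.re_le_norm w
    rcases lt_or_eq_of_le h2 with h | h
    · simpa using h
    · exfalso
      apply h1
      have h3 : w.re * w.re + w.im * w.im = 1 := by
        rw [← Complex.normSq_apply, Complex.normSq_eq_norm_sq, hw]; norm_num
      rw [h] at h3
      have h4 : w.im = 0 := by nlinarith
      exact Complex.ext (by simpa using h) (by simpa using h4)
  have hB : Tendsto (fun r : ℝ => -Complex.log (1 - w * (r : ℂ))) (nhdsWithin 1 (Set.Iio 1))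
      (nhds (-Complex.log (1 - w))) := by
    have : ContinuousAt (fun r : ℝ => -Complex.log (1 - w * (r : ℂ))) 1 := by
      refine (ContinuousAt.clog (by fun_prop) (by simpa using hslit)).neg
    have h := this.tendsto
    simp only [Complex.ofReal_one, mul_one] at h
    exact h.mono_left nhdsWithin_le_nhds
  rw [tendsto_map'_iff] at hA
  have hE : (fun r : ℝ => -Complex.log (1 - w * (r : ℂ))) =ᶠ[nhdsWithin 1 (Set.Iio 1)]
      ((fun z : ℂ => ∑' n : ℕ, w ^ n / (n : ℂ) * z ^ n) ∘ Complex.ofReal) := by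
    have h0 : ∀ᶠ r : ℝ in nhdsWithin 1 (Set.Iio 1), r ∈ Set.Ioo (0 : ℝ) 1 :=
      Ioo_mem_nhdsLT (by norm_num)
    filter_upwards [h0] with r hr
    have hn : ‖w * (r : ℂ)‖ < 1 := by
      rw [norm_mul, hw, one_mul, Complex.norm_real, Real.norm_eq_abs, abs_of_pos hr.1]
      exact hr.2
    rw [← (Complex.hasSum_taylorSeries_neg_log hn).tsum_eq]
    refine tsum_congr fun n => ?_
    rw [mul_pow]; ring
  have := tendsto_nhds_unique hA (hB.congr' hE)
  rwa [← this]

lemma aux_sin (x : ℝ) (h0 : 0 < x) (h2 : x < 2 * π) :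
    Tendsto (fun M : ℕ => ∑ l ∈ Finset.Icc 1 M, Real.sin (l * x) / l) atTop
      (nhds ((π - x) / 2)) := by
  have hs : 0 < Real.sin (x / 2) := Real.sin_pos_of_pos_of_lt_pi (by linarith) (by linarith)
  have hid : 1 - Complex.exp (x * Complex.I) =
      ((2 * Real.sin (x / 2) : ℝ) : ℂ) *
        (Complex.cos (((x - π) / 2 : ℝ) : ℂ) + Complex.sin (((x - π) / 2 : ℝ) : ℂ) * Complex.I) := by
    have hx : x = 2 * (x / 2) := by ring
    have e : (x - π) / 2 = x / 2 - π / 2 := by ring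
    have e1 : Real.cos x = 1 - 2 * Real.sin (x / 2) ^ 2 := by
      conv_lhs => rw [hx, Real.cos_two_mul, Real.cos_sq']
      ring
    have e2 : Real.sin x = 2 * Real.sin (x / 2) * Real.cos (x / 2) := by
      conv_lhs => rw [hx, Real.sin_two_mul]
    rw [Complex.exp_mul_I, ← Complex.ofReal_cos, ← Complex.ofReal_sin, ← Complex.ofReal_cos,
      ← Complex.ofReal_sin, e, Real.cos_sub_pi_div_two, Real.sin_sub_pi_div_two, e1, e2]
    push_cast
    ring
  have harg : (1 - Complex.exp (x * Complex.I)).arg = (x - π) / 2 := by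
    rw [hid]
    exact Complex.arg_mul_cos_add_sin_mul_I (by positivity)
      ⟨by linarith, by linarith [Real.pi_pos]⟩
  have hne : Complex.exp (x * Complex.I) ≠ 1 := by
    intro h
    have hr := congrArg Complex.re hid
    rw [h, ← Complex.ofReal_cos, ← Complex.ofReal_sin,
      show (x - π) / 2 = x / 2 - π / 2 by ring, Real.cos_sub_pi_div_two] at hr
    simp only [Complex.sub_re, Complex.re_ofReal_mul, Complex.add_re, Complex.ofReal_re,
      Complex.I_re, Complex.I_im, Complex.ofReal_im] at hr
    nlinarith
  have hT := aux_log _ (Complex.norm_exp_ofReal_mul_I x) hne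
  have hT2 := (Complex.continuous_im.tendsto _).comp hT
  rw [Complex.neg_im, Complex.log_im, harg, ← tendsto_add_atTop_iff_nat 1] at hT2
  convert hT2 using 2 with M
  · simp only [Function.comp]
    rw [Complex.im_sum, Finset.range_eq_Ico, Finset.sum_eq_sum_Ico_succ_bot (Nat.succ_pos M)]
    simp only [Nat.cast_zero, div_zero, Complex.zero_im, zero_add]
    refine Finset.sum_congr (by ext; simp) fun l _ => ?_
    rw [← Complex.exp_nat_mul, Complex.div_natCast_im, ← mul_assoc, ← Complex.ofReal_natCast,
      ← Complex.ofReal_mul, Complex.exp_ofReal_mul_I_im]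
  · ring

lemma aux_alt (x : ℝ) (h0 : 0 < x) (h2 : x < π) :
    Tendsto (fun M : ℕ => ∑ l ∈ Finset.Icc 1 M, ((2 + (-1 : ℝ) ^ l) / l) * Real.sin (l * x)) atTop
      (nhds (π - 3 / 2 * x)) := by
  have hA := (aux_sin x h0 (by linarith)).const_mul 2
  have hB := aux_sin (x + π) (by linarith) (by linarith)
  convert hA.add hB using 2 with M
  · rw [Finset.mul_sum, ← Finset.sum_add_distrib]
    refine Finset.sum_congr rfl fun l _ => ?_
    rw [mul_add, Real.sin_add_nat_mul_pi]
    ring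
  · ring

/-- General real-angle form of Theorem 1 of the paper: for positive angles `x, y, z < π`
summing to `2π`, the series `∑ ((2 + (−1)^l)/l)(sin lx + sin ly + sin lz)` converges to `0`. -/
theorem stmt_1 (x y z : ℝ) (hx0 : 0 < x) (hxπ : x < π) (hy0 : 0 < y) (hyπ : y < π)
    (hz0 : 0 < z) (hzπ : z < π) (hsum : x + y + z = 2 * π) :
    Tendsto
      (fun M : ℕ => ∑ l ∈ Finset.Icc 1 M,
        ((2 + (-1 : ℝ) ^ l) / l) * (Real.sin (l * x) + Real.sin (l * y) + Real.sin (l * z)))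
      atTop (nhds 0) := by
  have h := ((aux_alt x hx0 hxπ).add (aux_alt y hy0 hyπ)).add (aux_alt z hz0 hzπ)
  convert h using 2 with M
  · rw [← Finset.sum_add_distrib, ← Finset.sum_add_distrib]
    refine Finset.sum_congr rfl fun l _ => ?_
    ring
  · linarith
end

section
/- Let N be an even positive integer and let i be an integer with 1 ≤ i ≤ N/2 − 1. Then ∑_{l=1}^{N/2−1} (2 + (−1)^l) · (π/N) · cot(πl/N) · sin(2πli/N) = π − 3πi/N. -/
open Real

lemma aux_tel (a : ℝ) (n : ℕ) :
    2 * sin (a / 2) * ∑ l ∈ Finset.Icc 1 n, cos (l * a) = sin ((n + 1 / 2) * a) - sin (a / 2) := by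
  induction n with
  | zero => simp; ring_nf
  | succ n ih =>
    rw [Finset.sum_Icc_succ_top (by omega), mul_add, ih]
    have h1 : ((n : ℝ) + 1 / 2) * a = ((n + 1 : ℕ) : ℝ) * a - a / 2 := by push_cast; ring
    have h2 : (((n + 1 : ℕ) : ℝ) + 1 / 2) * a = ((n + 1 : ℕ) : ℝ) * a + a / 2 := by ring
    rw [h1, h2, sin_add, sin_sub]; ring

lemma aux_D (M k : ℕ) (hk : 0 < k) (hkM : k < 2 * M) :
    ∑ l ∈ Finset.Icc 1 (M - 1), cos (l * (π * k / M)) = -(1 + (-1 : ℝ) ^ k) / 2 := by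
  have hM : (0 : ℝ) < M := by exact_mod_cast (by omega : 0 < M)
  have hk' : (0 : ℝ) < k := by exact_mod_cast hk
  have hkM' : (k : ℝ) < 2 * M := by exact_mod_cast hkM
  have hs : 0 < sin (π * k / M / 2) := by
    apply sin_pos_of_pos_of_lt_pi
    · positivity
    · rw [div_div, div_lt_iff₀ (by positivity)]
      nlinarith [pi_pos]
  have h := aux_tel (π * k / M) (M - 1)
  have hc : ((M - 1 : ℕ) : ℝ) = M - 1 := by
    rw [Nat.cast_sub (by omega)]; simp
  have e : (((M - 1 : ℕ) : ℝ) + 1 / 2) * (π * k / M) = k * π - π * k / M / 2 := by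
    rw [hc]; field_simp; ring
  rw [e, sin_sub, sin_nat_mul_pi, cos_nat_mul_pi] at h
  apply mul_left_cancel₀ (mul_pos two_pos hs).ne'
  rw [h]; ring

lemma aux_E (M k : ℕ) (hM : 0 < M) (hkM : k < M) :
    ∑ l ∈ Finset.Icc 1 (M - 1), (-1 : ℝ) ^ l * cos (l * (π * k / M))
      = -(1 + (-1 : ℝ) ^ (k + M)) / 2 := by
  rw [← aux_D M (k + M) (by omega) (by omega)]
  apply Finset.sum_congr rfl
  intro l _
  have hM' : (M : ℝ) ≠ 0 := by exact_mod_cast hM.ne'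
  have e : (l : ℝ) * (π * ((k + M : ℕ) : ℝ) / M) = l * (π * k / M) + l * π := by
    push_cast; field_simp
  rw [e, cos_add, sin_nat_mul_pi, cos_nat_mul_pi]; ring

lemma aux_C (M k : ℕ) (hM : 0 < M) (hkM : k < M) :
    ∑ l ∈ Finset.Icc 1 (M - 1), (2 + (-1 : ℝ) ^ l) * cos (l * (π * k / M))
      = (if k = 0 then 2 * (M : ℝ) else 0) - (1 + (-1 : ℝ) ^ k) - (1 + (-1 : ℝ) ^ (k + M)) / 2 := by
  simp only [add_mul, Finset.sum_add_distrib, aux_E M k hM hkM, ← Finset.mul_sum]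
  split_ifs with h
  · subst h
    simp [Nat.cast_sub (show 1 ≤ M by omega)]; ring
  · rw [aux_D M k (by omega) (by omega)]; ring

lemma aux_S (M i : ℕ) (hi : i + 1 < M) :
    ∑ l ∈ Finset.Icc 1 (M - 1),
      (2 + (-1 : ℝ) ^ l) * (Real.cot (π * l / (2 * M)) * sin (l * (π * (i + 1 : ℕ) / M)))
      = 2 * M - 3 * (i + 1 : ℕ) := by
  have hM : 0 < M := by omega
  have hM' : (0 : ℝ) < M := by exact_mod_cast hM
  have step : ∀ j : ℕ, ∑ l ∈ Finset.Icc 1 (M - 1),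
      (2 + (-1 : ℝ) ^ l) * (Real.cot (π * l / (2 * M)) * sin (l * (π * (j + 1 : ℕ) / M)))
      = ∑ l ∈ Finset.Icc 1 (M - 1),
      (2 + (-1 : ℝ) ^ l) * (Real.cot (π * l / (2 * M)) * sin (l * (π * (j : ℕ) / M)))
      + (∑ l ∈ Finset.Icc 1 (M - 1), (2 + (-1 : ℝ) ^ l) * cos (l * (π * (j + 1 : ℕ) / M))
      + ∑ l ∈ Finset.Icc 1 (M - 1), (2 + (-1 : ℝ) ^ l) * cos (l * (π * (j : ℕ) / M))) := by
    intro j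
    rw [← Finset.sum_add_distrib, ← Finset.sum_add_distrib]
    apply Finset.sum_congr rfl
    intro l hl
    rw [Finset.mem_Icc] at hl
    have hl0 : (0 : ℝ) < l := by exact_mod_cast hl.1
    have hlM : (l : ℝ) < M := by exact_mod_cast (by omega : l < M)
    have hs : 0 < sin (π * l / (2 * M)) := by
      apply sin_pos_of_pos_of_lt_pi
      · positivity
      · rw [div_lt_iff₀ (by positivity)]
        nlinarith [pi_pos]
    rw [← mul_add, ← mul_add]
    congr 1
    rw [Real.cot_eq_cos_div_sin]
    set t := π * l / (2 * M) with ht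
    have e1 : (l : ℝ) * (π * (j + 1 : ℕ) / M) = l * (π * j / M) + 2 * t := by
      rw [ht]; push_cast; field_simp
    rw [e1, sin_add, cos_add, sin_two_mul, cos_two_mul]
    field_simp
    have := sin_sq_add_cos_sq t
    have h2 : cos t ^ 2 = 1 - sin t ^ 2 := by linarith
    ring_nf
    try simp only [show cos t ^ 3 = cos t * (1 - sin t ^ 2) by rw [← h2]; ring, h2]
    try ring
  induction i with
  | zero =>
    rw [step, aux_C M _ hM hi, aux_C M _ hM hM]
    simp [pow_add]; ring
  | succ i ih =>
    rw [step, ih (by omega), aux_C M _ hM hi, aux_C M _ hM (by omega)]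
    simp [pow_add]; ring

theorem stmt_9 (N : ℕ) (hN : 0 < N) (hNeven : Even N) (i : ℕ) (hi1 : 1 ≤ i)
    (hi : i ≤ N / 2 - 1) :
    ∑ l ∈ Finset.Icc 1 (N / 2 - 1),
      (2 + (-1 : ℝ) ^ l) * (π / N) * Real.cot (π * l / N) * Real.sin (2 * π * l * i / N) =
      π - 3 * π * i / N := by
  obtain ⟨M, rfl⟩ := hNeven
  obtain ⟨j, rfl⟩ : ∃ j, i = j + 1 := ⟨i - 1, by omega⟩
  have hd : (M + M) / 2 = M := by omega
  rw [hd] at hi ⊢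
  have hM' : (M : ℝ) ≠ 0 := by exact_mod_cast (by omega : M ≠ 0)
  have h := aux_S M j (by omega)
  have hc : ((M + M : ℕ) : ℝ) = 2 * M := by push_cast; ring
  rw [hc]
  calc _ = (π / (2 * M)) * ∑ l ∈ Finset.Icc 1 (M - 1),
      (2 + (-1 : ℝ) ^ l) * (Real.cot (π * l / (2 * M)) * sin (l * (π * (j + 1 : ℕ) / M))) := by
        rw [Finset.mul_sum]
        apply Finset.sum_congr rfl
        intro l _
        have e : 2 * π * l * ((j + 1 : ℕ) : ℝ) / (2 * M) = l * (π * (j + 1 : ℕ) / M) := by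
          field_simp
        rw [e]; ring
    _ = _ := by rw [h]; field_simp
end
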